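/- Let G be a finite simple graph on vertex set {1, …, n} with edge set E, and let L = D − A be its combinatorial Laplacian matrix (D the diagonal degree matrix, A the adjacency matrix). Let v_1, …, v_r be orthonormal eigenvectors of L with eigenvalues λ_1, …, λ_r satisfying 0 ≤ λ_k ≤ 1 for all k. For each vertex i define the weighted spectral embedding V_i ∈ ℝ^r whose k-th coordinate is √(1−λ_k) · (v_k)_i. Then ∑_{{i,j} ∈ E} ‖V_i − V_j‖₂² ≤ r/4, where the sum is over each edge counted once. -/

import Mathlib

open Matrix Finset

namespace SimpleGraph

variable {V : Type*} [Fintype V] [DecidableEq V] (G : SimpleGraph V) [DecidableRel G.Adj]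

theorem sum_sum_adj_eq_two_nsmul_sum_edgeFinset {M : Type*} [AddCommMonoid M] (f : Sym2 V → M) :
    ∑ i, ∑ j, (if G.Adj i j then f s(i, j) else 0) = 2 • ∑ e ∈ G.edgeFinset, f e := by
  have hmaps : ∀ p ∈ (univ : Finset (V × V)).filter (fun p => G.Adj p.1 p.2),
      s(p.1, p.2) ∈ G.edgeFinset := by
    simp
  rw [← Fintype.sum_prod_type' (f := fun i j => if G.Adj i j then f s(i, j) else 0),
    ← Finset.sum_filter, ← Finset.sum_fiberwise_of_maps_to hmaps, Finset.smul_sum]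
  refine Finset.sum_congr rfl fun e he => ?_
  induction e with | _ a b =>
  have hab : G.Adj a b := by simpa using he
  have hfiber : ((univ : Finset (V × V)).filter (fun p => G.Adj p.1 p.2)).filter
      (fun p => s(p.1, p.2) = s(a, b)) = {(a, b), (b, a)} := by
    ext ⟨x, y⟩
    simp only [mem_filter, mem_univ, true_and, Sym2.eq_iff, mem_insert, mem_singleton,
      Prod.mk.injEq]
    constructor
    · exact fun h => h.2
    · rintro (⟨rfl, rfl⟩ | ⟨rfl, rfl⟩)
      · exact ⟨hab, Or.inl ⟨rfl, rfl⟩⟩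
      · exact ⟨hab.symm, Or.inr ⟨rfl, rfl⟩⟩
  have hne : (a, b) ≠ (b, a) := fun h => hab.ne (Prod.ext_iff.mp h).1
  rw [hfiber, Finset.sum_pair hne, Sym2.eq_swap (a := b), two_nsmul]

theorem dotProduct_lapMatrix_mulVec {R : Type*} [Field R] [CharZero R] (x : V → R) :
    x ⬝ᵥ (G.lapMatrix R *ᵥ x) =
      ∑ e ∈ G.edgeFinset, Sym2.lift ⟨fun i j => (x i - x j) ^ 2, fun i j => by ring⟩ e := by
  rw [← toLinearMap₂'_apply', lapMatrix_toLinearMap₂']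
  have h := G.sum_sum_adj_eq_two_nsmul_sum_edgeFinset
    (Sym2.lift ⟨fun i j => (x i - x j) ^ 2, fun i j => by ring⟩)
  simp only [Sym2.lift_mk] at h
  rw [h, nsmul_eq_mul, Nat.cast_ofNat, mul_div_cancel_left₀ _ two_ne_zero]

end SimpleGraph

/-- For a finite simple graph `G` with combinatorial Laplacian `L = D - A`, orthonormal
eigenvectors `v 1, …, v r` of `L` with eigenvalues `0 ≤ lam k ≤ 1`, and weighted spectral
embedding `V i k = √(1 - lam k) * (v k) i`, the total squared embedding distance over the
edges (each edge counted once) is at most `r / 4`. -/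
theorem weighted_spectral_embedding_edge_bound
    (n r : ℕ) (G : SimpleGraph (Fin n)) [DecidableRel G.Adj]
    (lam : Fin r → ℝ) (v : Fin r → Fin n → ℝ)
    (horth : ∀ k l, v k ⬝ᵥ v l = if k = l then (1 : ℝ) else 0)
    (heig : ∀ k, (G.lapMatrix ℝ) *ᵥ v k = lam k • v k)
    (hlam0 : ∀ k, 0 ≤ lam k) (hlam1 : ∀ k, lam k ≤ 1)
    (V : Fin n → Fin r → ℝ)
    (hV : ∀ i k, V i k = Real.sqrt (1 - lam k) * v k i) :
    ∑ e ∈ G.edgeFinset,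
      Sym2.lift ⟨fun i j => ∑ k, (V i k - V j k) ^ 2,
        fun i j => Finset.sum_congr rfl fun k _ => by ring⟩ e ≤ (r : ℝ) / 4 := by
  have hsplit : ∀ e ∈ G.edgeFinset, Sym2.lift ⟨fun i j => ∑ k, (V i k - V j k) ^ 2,
        fun i j => Finset.sum_congr rfl fun k _ => by ring⟩ e =
      ∑ k, (1 - lam k) *
        Sym2.lift ⟨fun i j => (v k i - v k j) ^ 2, fun i j => by ring⟩ e := by
    intro e _
    induction e with | _ i j =>
    simp only [Sym2.lift_mk]
    refine Finset.sum_congr rfl fun k _ => ?_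
    rw [hV, hV, ← mul_sub, mul_pow, Real.sq_sqrt (sub_nonneg.mpr (hlam1 k))]
  have henergy : ∀ k, ∑ e ∈ G.edgeFinset,
      Sym2.lift ⟨fun i j => (v k i - v k j) ^ 2, fun i j => by ring⟩ e = lam k := by
    intro k
    rw [← G.dotProduct_lapMatrix_mulVec, heig, dotProduct_smul, horth, if_pos rfl, smul_eq_mul,
      mul_one]
  rw [Finset.sum_congr rfl hsplit, Finset.sum_comm]
  simp_rw [← Finset.mul_sum, henergy]
  calc ∑ k, (1 - lam k) * lam k ≤ ∑ _k : Fin r, (1 / 4 : ℝ) :=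
        Finset.sum_le_sum fun k _ => by nlinarith [sq_nonneg (lam k - 1 / 2)]
    _ = (r : ℝ) / 4 := by simp [div_eq_mul_inv]
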